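/- Let A, B, C be perfect matchings in a graph whose pairwise symmetric differences A Δ B, A Δ C, B Δ C are finite. Then the triple A, B, C is flat (for every vertex v at least two of the edges A_v, B_v, C_v coincide, where A_v is the unique edge of A incident to v) if and only if there exist a perfect matching K and a finite set S of pairwise independent even cycles together with a partition S = X ⊔ Y ⊔ Z such that A Δ K = ⋃_{s∈X} s, B Δ K = ⋃_{s∈Y} s, and C Δ K = ⋃_{s∈Z} s. -/

import Mathlib

open scoped symmDiff

variable {V E : Type*}

/-- The set of vertices of a set `s` of edges. -/
def bdry (ends : E → Finset V) (s : Set E) : Set V := ⋃ e ∈ s, (ends e : Set V)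

/-- A set `s` of edges is cyclic if it is finite and every vertex of `s` is incident
to exactly two edges of `s`. -/
def IsCyclicSet (ends : E → Finset V) (s : Set E) : Prop :=
  s.Finite ∧ ∀ v ∈ bdry ends s, {e ∈ s | v ∈ ends e}.ncard = 2

/-- A cycle is a nonempty cyclic set of edges whose only nonempty cyclic subset is
itself. -/
def IsCycle (ends : E → Finset V) (s : Set E) : Prop :=
  IsCyclicSet ends s ∧ s.Nonempty ∧
    ∀ t : Set E, t ⊆ s → IsCyclicSet ends t → t.Nonempty → t = s

/-- An even cycle is a cycle with an even number of edges. -/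
def IsEvenCycle (ends : E → Finset V) (s : Set E) : Prop :=
  IsCycle ends s ∧ Even s.ncard

/-- A matching: distinct edges share no vertices. -/
def IsMatchingSet (ends : E → Finset V) (A : Set E) : Prop :=
  ∀ e ∈ A, ∀ f ∈ A, e ≠ f → Disjoint (ends e : Set V) (ends f : Set V)

/-- A perfect matching: every vertex is incident to exactly one edge of `A`. -/
def IsPerfectMatching (ends : E → Finset V) (A : Set E) : Prop :=
  ∀ v : V, ∃! e : E, e ∈ A ∧ v ∈ ends e

/-- `h` is a half of the even cycle `s` if `h` and `s \ h` are matchings. -/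
def IsHalf (ends : E → Finset V) (h s : Set E) : Prop :=
  h ⊆ s ∧ IsMatchingSet ends h ∧ IsMatchingSet ends (s \ h)

/-- `B` is obtained from `A` by gliding along the even cycle `s`. -/
def IsGliding (ends : E → Finset V) (s A B : Set E) : Prop :=
  IsEvenCycle ends s ∧ IsHalf ends (A ∩ s) s ∧ B = s ∆ A

/-- Perfect matchings `A, B, C` form a flat triple if every vertex is incident to
an edge belonging to at least two of `A, B, C` (equivalently, at least two of the
edges `A_v, B_v, C_v` coincide). -/
def FlatTriple (ends : E → Finset V) (A B C : Set E) : Prop :=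
  ∀ v : V, ∃ e : E, v ∈ ends e ∧
    ((e ∈ A ∧ e ∈ B) ∨ (e ∈ A ∧ e ∈ C) ∨ (e ∈ B ∧ e ∈ C))

section GraphLemmas

variable {ends : E → Finset V}

lemma mem_bdry {s : Set E} {v : V} : v ∈ bdry ends s ↔ ∃ e ∈ s, v ∈ ends e := by
  simp [bdry]

lemma bdry_mono {s t : Set E} (h : s ⊆ t) : bdry ends s ⊆ bdry ends t := by
  intro v hv
  obtain ⟨e, he, hve⟩ := mem_bdry.1 hv
  exact mem_bdry.2 ⟨e, h he, hve⟩

lemma bdry_inter_eq_empty_of_mem_sUnion {X Y : Set (Set E)}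
    (h : bdry ends (⋃₀ X) ∩ bdry ends (⋃₀ Y) = ∅) {s t : Set E} (hs : s ∈ X) (ht : t ∈ Y) :
    bdry ends s ∩ bdry ends t = ∅ :=
  Set.subset_empty_iff.1 (h ▸ Set.inter_subset_inter
    (bdry_mono (Set.subset_sUnion_of_mem hs)) (bdry_mono (Set.subset_sUnion_of_mem ht)))

lemma pairwise_union_of_bdry_sUnion_inter {X Y : Set (Set E)}
    (hX : X.Pairwise fun s t => bdry ends s ∩ bdry ends t = ∅)
    (hY : Y.Pairwise fun s t => bdry ends s ∩ bdry ends t = ∅)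
    (h : bdry ends (⋃₀ X) ∩ bdry ends (⋃₀ Y) = ∅) :
    (X ∪ Y).Pairwise fun s t => bdry ends s ∩ bdry ends t = ∅ := by
  have hXY : ∀ s ∈ X, ∀ t ∈ Y, bdry ends s ∩ bdry ends t = ∅ := fun s hs t ht =>
    bdry_inter_eq_empty_of_mem_sUnion h hs ht
  exact Set.pairwise_union.2 ⟨hX, hY, fun s hs t ht _ =>
    ⟨hXY s hs t ht, Set.inter_comm _ _ ▸ hXY s hs t ht⟩⟩

lemma bdry_nonempty (hcard : ∀ e, (ends e).card = 2) {s : Set E} (h : s.Nonempty) :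
    (bdry ends s).Nonempty := by
  obtain ⟨e, he⟩ := h
  obtain ⟨v, hv⟩ : (ends e).Nonempty := Finset.card_pos.1 (by rw [hcard e]; norm_num)
  exact ⟨v, mem_bdry.2 ⟨e, he, hv⟩⟩

lemma IsPerfectMatching.eq_of_mem {A : Set E} (hA : IsPerfectMatching ends A) {e f : E} {v : V}
    (he : e ∈ A) (hf : f ∈ A) (hve : v ∈ ends e) (hvf : v ∈ ends f) : e = f :=
  (hA v).unique ⟨he, hve⟩ ⟨hf, hvf⟩

lemma IsPerfectMatching.isMatchingSet_of_subset {A s : Set E} (hA : IsPerfectMatching ends A)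
    (hs : s ⊆ A) : IsMatchingSet ends s := by
  intro e he f hf hne
  rw [Set.disjoint_left]
  intro v hve hvf
  exact hne (hA.eq_of_mem (hs he) (hs hf) hve hvf)

/-- A cyclic subset of a cyclic set contains all the edges at each of its vertices. -/
lemma IsCyclicSet.mem_of_mem_bdry {s t : Set E} (hs : IsCyclicSet ends s)
    (ht : IsCyclicSet ends t) (hst : s ⊆ t) {v : V} (hv : v ∈ bdry ends s) {e : E}
    (he : e ∈ t) (hve : v ∈ ends e) : e ∈ s := by
  have h : {e ∈ s | v ∈ ends e} = {e ∈ t | v ∈ ends e} :=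
    Set.eq_of_subset_of_ncard_le (fun f hf => ⟨hst hf.1, hf.2⟩)
      (by rw [hs.2 v hv, ht.2 v (bdry_mono hst hv)]) (ht.1.subset (Set.sep_subset _ _))
  have he' : e ∈ {e ∈ t | v ∈ ends e} := ⟨he, hve⟩
  rw [← h] at he'
  exact he'.1

lemma IsCyclicSet.bdry_inter_bdry_sdiff {s t : Set E} (hs : IsCyclicSet ends s)
    (ht : IsCyclicSet ends t) (hst : s ⊆ t) : bdry ends s ∩ bdry ends (t \ s) = ∅ := by
  rw [Set.eq_empty_iff_forall_notMem]
  rintro v ⟨hv, hv'⟩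
  obtain ⟨e, he, hve⟩ := mem_bdry.1 hv'
  exact he.2 (hs.mem_of_mem_bdry ht hst hv he.1 hve)

lemma IsCyclicSet.sdiff {s t : Set E} (hs : IsCyclicSet ends s)
    (ht : IsCyclicSet ends t) (hst : s ⊆ t) : IsCyclicSet ends (t \ s) := by
  refine ⟨ht.1.subset Set.sdiff_subset, fun v hv => ?_⟩
  rw [← ht.2 v (bdry_mono Set.sdiff_subset hv)]
  congr 1
  ext e
  refine ⟨fun he => ⟨he.1.1, he.2⟩, fun he => ⟨⟨he.1, fun hes => ?_⟩, he.2⟩⟩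
  exact (hs.bdry_inter_bdry_sdiff ht hst).subset ⟨mem_bdry.2 ⟨e, hes, he.2⟩, hv⟩

/-- Every cyclic set is a union of finitely many pairwise independent cycles. -/
lemma IsCyclicSet.exists_cycles {t : Set E} (ht : IsCyclicSet ends t) :
    ∃ D : Set (Set E), D.Finite ∧ (∀ s ∈ D, IsCycle ends s) ∧
      (D.Pairwise fun s u => bdry ends s ∩ bdry ends u = ∅) ∧ ⋃₀ D = t := by
  induction hn : t.ncard using Nat.strong_induction_on generalizing t with
  | _ n ih =>
  subst hn
  rcases t.eq_empty_or_nonempty with rfl | hne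
  · exact ⟨∅, by simp⟩
  by_cases hcyc : IsCycle ends t
  · exact ⟨{t}, by simpa using hcyc⟩
  obtain ⟨u, hut, hu, hu0, hne'⟩ : ∃ u ⊆ t, IsCyclicSet ends u ∧ u.Nonempty ∧ u ≠ t := by
    by_contra! h
    exact hcyc ⟨ht, hne, h⟩
  have hdisj := hu.bdry_inter_bdry_sdiff ht hut
  have hlt : (t \ u).ncard < t.ncard := by
    refine Set.ncard_lt_ncard ⟨Set.sdiff_subset, fun h => ?_⟩ ht.1
    obtain ⟨e, he⟩ := hu0
    exact (h (hut he)).2 he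
  obtain ⟨D, hDf, hDc, hDp, hDu⟩ :=
    ih _ (Set.ncard_lt_ncard (hut.ssubset_of_ne hne') ht.1) hu rfl
  obtain ⟨D', hDf', hDc', hDp', hDu'⟩ := ih _ hlt (hu.sdiff ht hut) rfl
  refine ⟨D ∪ D', hDf.union hDf', ?_, ?_, ?_⟩
  · rintro s (hs | hs)
    exacts [hDc s hs, hDc' s hs]
  · exact pairwise_union_of_bdry_sUnion_inter hDp hDp' (by rwa [hDu, hDu'])
  · rw [Set.sUnion_union, hDu, hDu', Set.union_sdiff_cancel hut]

lemma IsMatchingSet.ncard_bdry (hcard : ∀ e, (ends e).card = 2) {M : Set E}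
    (hM : IsMatchingSet ends M) (hf : M.Finite) : (bdry ends M).ncard = 2 * M.ncard := by
  classical
  lift M to Finset E using hf
  have h : bdry ends (M : Set E) = (M.biUnion ends : Finset V) := by simp [bdry]
  rw [h, Set.ncard_coe_finset, Set.ncard_coe_finset, Finset.card_biUnion]
  · simp [hcard, mul_comm]
  · intro e he f hf hne
    exact Finset.disjoint_coe.1 (hM e he f hf hne)

/-- A cyclic set inside the symmetric difference of two perfect matchings alternates between
them, so it has evenly many edges. -/
lemma IsCyclicSet.even_ncard (hcard : ∀ e, (ends e).card = 2) {A K s : Set E}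
    (hA : IsPerfectMatching ends A) (hK : IsPerfectMatching ends K)
    (hs : IsCyclicSet ends s) (hsub : s ⊆ A ∆ K) : Even s.ncard := by
  have hK' : s \ A ⊆ K := by
    intro e he
    rcases hsub he.1 with h | h
    exacts [absurd h.1 he.2, h.1]
  have hvert : ∀ v ∈ bdry ends s, v ∈ bdry ends (s ∩ A) ∧ v ∈ bdry ends (s \ A) := by
    intro v hv
    obtain ⟨e, f, hef, h⟩ := Set.ncard_eq_two.1 (hs.2 v hv)
    have he : e ∈ s ∧ v ∈ ends e := h.superset (by simp)
    have hf : f ∈ s ∧ v ∈ ends f := h.superset (by simp)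
    by_cases heA : e ∈ A
    · have hfA : f ∉ A := fun hfA => hef (hA.eq_of_mem heA hfA he.2 hf.2)
      exact ⟨mem_bdry.2 ⟨e, ⟨he.1, heA⟩, he.2⟩, mem_bdry.2 ⟨f, ⟨hf.1, hfA⟩, hf.2⟩⟩
    · have hfA : f ∈ A := by
        by_contra hfA
        exact hef (hK.eq_of_mem (hK' ⟨he.1, heA⟩) (hK' ⟨hf.1, hfA⟩) he.2 hf.2)
      exact ⟨mem_bdry.2 ⟨f, ⟨hf.1, hfA⟩, hf.2⟩, mem_bdry.2 ⟨e, ⟨he.1, heA⟩, he.2⟩⟩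
  have h : bdry ends (s ∩ A) = bdry ends (s \ A) :=
    Set.Subset.antisymm (fun v hv => (hvert v (bdry_mono Set.inter_subset_left hv)).2)
      (fun v hv => (hvert v (bdry_mono Set.sdiff_subset hv)).1)
  have h1 := (hA.isMatchingSet_of_subset Set.inter_subset_right).ncard_bdry hcard
    (hs.1.subset (Set.inter_subset_left (t := A)))
  have h2 := (hK.isMatchingSet_of_subset hK').ncard_bdry hcard (hs.1.subset Set.sdiff_subset)
  have h3 := Set.ncard_inter_add_ncard_sdiff_eq_ncard s A hs.1
  rw [h] at h1
  exact ⟨(s ∩ A).ncard, by omega⟩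

lemma IsPerfectMatching.isCyclicSet_symmDiff {A K : Set E} (hA : IsPerfectMatching ends A)
    (hK : IsPerfectMatching ends K) (hf : (A ∆ K).Finite) : IsCyclicSet ends (A ∆ K) := by
  refine ⟨hf, fun v hv => ?_⟩
  obtain ⟨a, ⟨haA, hva⟩, -⟩ := hA v
  obtain ⟨k, ⟨hkK, hvk⟩, -⟩ := hK v
  obtain ⟨e, he, hve⟩ := mem_bdry.1 hv
  have hak : a ∉ K ∧ k ∉ A := by
    constructor <;> intro h
    · obtain rfl := hK.eq_of_mem h hkK hva hvk
      rcases he with he | he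
      · exact he.2 (hA.eq_of_mem he.1 haA hve hva ▸ h)
      · exact he.2 (hK.eq_of_mem he.1 h hve hva ▸ haA)
    · obtain rfl := hA.eq_of_mem h haA hvk hva
      rcases he with he | he
      · exact he.2 (hA.eq_of_mem he.1 h hve hvk ▸ hkK)
      · exact he.2 (hK.eq_of_mem he.1 hkK hve hvk ▸ h)
  rw [Set.ncard_eq_two]
  refine ⟨a, k, fun h => hak.1 (h ▸ hkK), ?_⟩
  ext f
  constructor
  · rintro ⟨hf | hf, hvf⟩
    · exact Or.inl (hA.eq_of_mem hf.1 haA hvf hva)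
    · exact Or.inr (hK.eq_of_mem hf.1 hkK hvf hvk)
  · rintro (rfl | rfl)
    · exact ⟨Or.inl ⟨haA, hak.1⟩, hva⟩
    · exact ⟨Or.inr ⟨hkK, hak.2⟩, hvk⟩

/-- Two perfect matchings with finite symmetric difference differ by finitely many pairwise
independent even cycles. -/
lemma IsPerfectMatching.exists_evenCycles (hcard : ∀ e, (ends e).card = 2) {A K : Set E}
    (hA : IsPerfectMatching ends A) (hK : IsPerfectMatching ends K) (hf : (A ∆ K).Finite) :
    ∃ D : Set (Set E), D.Finite ∧ (∀ s ∈ D, IsEvenCycle ends s) ∧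
      (D.Pairwise fun s u => bdry ends s ∩ bdry ends u = ∅) ∧ A ∆ K = ⋃₀ D := by
  obtain ⟨D, hDf, hDc, hDp, hDu⟩ := (hA.isCyclicSet_symmDiff hK hf).exists_cycles
  refine ⟨D, hDf, fun s hs => ⟨hDc s hs, ?_⟩, hDp, hDu.symm⟩
  exact (hDc s hs).1.even_ncard hcard hA hK (hDu ▸ Set.subset_sUnion_of_mem hs)

/-- The edges lying in at least two of three sets. -/
def majority (A B C : Set E) : Set E :=
  {e | (e ∈ A ∧ e ∈ B) ∨ (e ∈ A ∧ e ∈ C) ∨ (e ∈ B ∧ e ∈ C)}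

lemma majority_swap_left (A B C : Set E) : majority A B C = majority B A C := by
  ext e
  simp only [majority, Set.mem_ofPred_eq]
  tauto

lemma majority_rotate (A B C : Set E) : majority A B C = majority C A B := by
  ext e
  simp only [majority, Set.mem_ofPred_eq]
  tauto

lemma symmDiff_majority_subset (A B C : Set E) : A ∆ majority A B C ⊆ A ∆ B := by
  intro e
  simp only [majority, Set.mem_symmDiff, Set.mem_ofPred_eq]
  tauto

lemma FlatTriple.isPerfectMatching_majority {A B C : Set E} (h : FlatTriple ends A B C)
    (hA : IsPerfectMatching ends A) (hB : IsPerfectMatching ends B)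
    (hC : IsPerfectMatching ends C) : IsPerfectMatching ends (majority A B C) := by
  intro v
  obtain ⟨e, hve, he⟩ := h v
  refine ⟨e, ⟨he, hve⟩, ?_⟩
  rintro f ⟨hf, hvf⟩
  have h1 : f ∈ A → e ∈ A → f = e := fun h h' => hA.eq_of_mem h h' hvf hve
  have h2 : f ∈ B → e ∈ B → f = e := fun h h' => hB.eq_of_mem h h' hvf hve
  have h3 : f ∈ C → e ∈ C → f = e := fun h h' => hC.eq_of_mem h h' hvf hve
  simp only [majority, Set.mem_ofPred_eq] at hf
  tauto

lemma IsPerfectMatching.notMem_of_mem_bdry_symmDiff {A K : Set E} (hA : IsPerfectMatching ends A)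
    (hK : IsPerfectMatching ends K) {v : V} (hv : v ∈ bdry ends (A ∆ K)) {k : E} (hk : k ∈ K)
    (hvk : v ∈ ends k) : k ∉ A := by
  intro hkA
  obtain ⟨e, he, hve⟩ := mem_bdry.1 hv
  rcases he with he | he
  · exact he.2 (hA.eq_of_mem he.1 hkA hve hvk ▸ hk)
  · exact he.2 (hK.eq_of_mem he.1 hk hve hvk ▸ hkA)

lemma bdry_symmDiff_majority_inter {A B C : Set E} (hA : IsPerfectMatching ends A)
    (hB : IsPerfectMatching ends B) (hK : IsPerfectMatching ends (majority A B C)) :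
    bdry ends (A ∆ majority A B C) ∩ bdry ends (B ∆ majority A B C) = ∅ := by
  rw [Set.eq_empty_iff_forall_notMem]
  rintro v ⟨hvA, hvB⟩
  obtain ⟨k, ⟨hk, hvk⟩, -⟩ := hK v
  have h1 := hA.notMem_of_mem_bdry_symmDiff hK hvA hk hvk
  have h2 := hB.notMem_of_mem_bdry_symmDiff hK hvB hk hvk
  simp only [majority, Set.mem_ofPred_eq] at hk
  tauto

lemma disjoint_of_bdry_sUnion_inter (hcard : ∀ e, (ends e).card = 2) {X Y : Set (Set E)}
    (hX : ∀ s ∈ X, IsEvenCycle ends s)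
    (h : bdry ends (⋃₀ X) ∩ bdry ends (⋃₀ Y) = ∅) : Disjoint X Y := by
  rw [Set.disjoint_left]
  intro s hs hs'
  have hempty := bdry_inter_eq_empty_of_mem_sUnion h hs hs'
  rw [Set.inter_self] at hempty
  exact (bdry_nonempty hcard (hX s hs).1.2.1).ne_empty hempty

/-- An edge missing from two matchings that arise from one containing it would be an edge of
two different cycles. -/
lemma mem_or_mem_of_symmDiff_eq_sUnion {A B K : Set E} {S X Y : Set (Set E)}
    (hS : S.Pairwise fun s t => bdry ends s ∩ bdry ends t = ∅) (hX : X ⊆ S) (hY : Y ⊆ S)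
    (hXY : Disjoint X Y) (hAX : A ∆ K = ⋃₀ X) (hBY : B ∆ K = ⋃₀ Y) {k : E} {v : V}
    (hk : k ∈ K) (hvk : v ∈ ends k) : k ∈ A ∨ k ∈ B := by
  by_contra! h
  obtain ⟨s, hs, hks⟩ : k ∈ ⋃₀ X := hAX ▸ Or.inr ⟨hk, h.1⟩
  obtain ⟨t, ht, hkt⟩ : k ∈ ⋃₀ Y := hBY ▸ Or.inr ⟨hk, h.2⟩
  have hst : s ≠ t := fun hst => Set.disjoint_left.1 hXY hs (hst ▸ ht)
  exact (hS (hX hs) (hY ht) hst).subset ⟨mem_bdry.2 ⟨k, hks, hvk⟩, mem_bdry.2 ⟨k, hkt, hvk⟩⟩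

end GraphLemmas

/-- Characterization from the proof of Theorem 7.3: three pairwise congruent
perfect matchings `A, B, C` form a flat triple if and only if they are obtained
from some perfect matching `K` by gliding along disjoint parts `X, Y, Z` of a
finite set `S` of pairwise independent even cycles. -/
theorem flatTriple_iff_cube (ends : E → Finset V)
    (hcard : ∀ e, (ends e).card = 2) (A B C : Set E)
    (hA : IsPerfectMatching ends A) (hB : IsPerfectMatching ends B)
    (hC : IsPerfectMatching ends C)
    (hAB : (A ∆ B).Finite) (hAC : (A ∆ C).Finite) (hBC : (B ∆ C).Finite) :
    FlatTriple ends A B C ↔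
      ∃ K : Set E, IsPerfectMatching ends K ∧
        ∃ S : Set (Set E), S.Finite ∧ (∀ s ∈ S, IsEvenCycle ends s) ∧
          (S.Pairwise fun s t => bdry ends s ∩ bdry ends t = ∅) ∧
          ∃ X Y Z : Set (Set E), X ∪ Y ∪ Z = S ∧
            Disjoint X Y ∧ Disjoint X Z ∧ Disjoint Y Z ∧
            A ∆ K = ⋃₀ X ∧ B ∆ K = ⋃₀ Y ∧ C ∆ K = ⋃₀ Z := by
  constructor
  · intro h
    have hK := h.isPerfectMatching_majority hA hB hC
    have hAB' := bdry_symmDiff_majority_inter hA hB hK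
    have hAC' : bdry ends (A ∆ majority A B C) ∩ bdry ends (C ∆ majority A B C) = ∅ := by
      rw [majority_rotate] at hK ⊢
      rw [Set.inter_comm]
      exact bdry_symmDiff_majority_inter hC hA hK
    have hBC' : bdry ends (B ∆ majority A B C) ∩ bdry ends (C ∆ majority A B C) = ∅ := by
      rw [majority_rotate, majority_rotate] at hK ⊢
      exact bdry_symmDiff_majority_inter hB hC hK
    obtain ⟨X, hXf, hXe, hXp, hX⟩ := hA.exists_evenCycles hcard hK
      (hAB.subset (symmDiff_majority_subset A B C))
    obtain ⟨Y, hYf, hYe, hYp, hY⟩ := hB.exists_evenCycles hcard hK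
      (hAB.subset (by
        rw [majority_swap_left, symmDiff_comm A B]
        exact symmDiff_majority_subset B A C))
    obtain ⟨Z, hZf, hZe, hZp, hZ⟩ := hC.exists_evenCycles hcard hK
      (hAC.subset (by
        rw [majority_rotate, symmDiff_comm A C]
        exact symmDiff_majority_subset C A B))
    rw [hX, hY] at hAB'
    rw [hX, hZ] at hAC'
    rw [hY, hZ] at hBC'
    refine ⟨majority A B C, hK, X ∪ Y ∪ Z, (hXf.union hYf).union hZf, ?_, ?_, X, Y, Z, rfl,
      disjoint_of_bdry_sUnion_inter hcard hXe hAB', disjoint_of_bdry_sUnion_inter hcard hXe hAC',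
      disjoint_of_bdry_sUnion_inter hcard hYe hBC', hX, hY, hZ⟩
    · rintro s ((hs | hs) | hs)
      exacts [hXe s hs, hYe s hs, hZe s hs]
    · refine pairwise_union_of_bdry_sUnion_inter
        (pairwise_union_of_bdry_sUnion_inter hXp hYp hAB') hZp ?_
      rw [Set.eq_empty_iff_forall_notMem]
      rintro v ⟨hv, hvZ⟩
      obtain ⟨e, he, hve⟩ := mem_bdry.1 hv
      rw [Set.sUnion_union] at he
      rcases he with he | he
      · exact hAC'.subset ⟨mem_bdry.2 ⟨e, he, hve⟩, hvZ⟩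
      · exact hBC'.subset ⟨mem_bdry.2 ⟨e, he, hve⟩, hvZ⟩
  · rintro ⟨K, hK, S, -, -, hS, X, Y, Z, rfl, hXY, hXZ, hYZ, hAX, hBY, hCZ⟩ v
    obtain ⟨k, ⟨hk, hvk⟩, -⟩ := hK v
    have hXS : X ⊆ X ∪ Y ∪ Z := fun s hs => Or.inl (Or.inl hs)
    have hYS : Y ⊆ X ∪ Y ∪ Z := fun s hs => Or.inl (Or.inr hs)
    have hZS : Z ⊆ X ∪ Y ∪ Z := fun s hs => Or.inr hs
    have h1 := mem_or_mem_of_symmDiff_eq_sUnion hS hXS hYS hXY hAX hBY hk hvk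
    have h2 := mem_or_mem_of_symmDiff_eq_sUnion hS hXS hZS hXZ hAX hCZ hk hvk
    have h3 := mem_or_mem_of_symmDiff_eq_sUnion hS hYS hZS hYZ hBY hCZ hk hvk
    exact ⟨k, hvk, by tauto⟩
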